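/- Let m, p, r be positive integers with p dividing m and m > p. If P is an admissible pinnacle set for Z_m ≀ S_{2r+1} that contains at least one element ξ^a(x) of color a < m−p, then P admits a witness in G(m,p,2r+1), i.e. P ∈ APS(m, p, 2r+1). -/

import Mathlib

open Finset

/-- `Prec p q` means the colored symbol `p = ξ^{p.1}(p.2)` precedes (is smaller than)
`q = ξ^{q.1}(q.2)`: `a > b`, or (`a = b` and `x > y`). -/
def Prec (p q : ℕ × ℕ) : Prop :=
  q.1 < p.1 ∨ (p.1 = q.1 ∧ q.2 < p.2)

instance : DecidableRel Prec := fun p q => by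
  unfold Prec; infer_instance

/-- `w : ℕ → ℕ × ℕ` (read on positions `1,…,n`) is an element of `Z_m ≀ S_n`:
each entry has color `< m` and norm in `{1,…,n}`, and the norms are pairwise distinct. -/
def IsGenPerm (m n : ℕ) (w : ℕ → ℕ × ℕ) : Prop :=
  (∀ i ∈ Finset.Icc 1 n, (w i).1 < m ∧ (w i).2 ∈ Finset.Icc 1 n) ∧
    Set.InjOn (fun i => (w i).2) (Set.Icc 1 n)

/-- The pinnacle set of the word `w`: values at interior positions `2 ≤ i ≤ n-1`
that strictly dominate both neighbors. -/
def pin (n : ℕ) (w : ℕ → ℕ × ℕ) : Finset (ℕ × ℕ) :=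
  ((Finset.Icc 2 (n - 1)).filter
      (fun i => Prec (w (i - 1)) (w i) ∧ Prec (w (i + 1)) (w i))).image w

/-- `P` is an admissible pinnacle set for `Z_m ≀ S_n`. -/
def IsAdmissible (m n : ℕ) (P : Finset (ℕ × ℕ)) : Prop :=
  ∃ w, IsGenPerm m n w ∧ pin n w = P

/-- `APS m n d` : admissible pinnacle sets for `Z_m ≀ S_n` of cardinality at most `d`. -/
def APS (m n d : ℕ) : Set (Finset (ℕ × ℕ)) :=
  {P | IsAdmissible m n P ∧ P.card ≤ d}

/-- The color sum `ε_w = e_1 + ⋯ + e_n` of a word `w`. -/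
def epsSum (n : ℕ) (w : ℕ → ℕ × ℕ) : ℕ :=
  ∑ i ∈ Finset.Icc 1 n, (w i).1

/-- `APSc m p n d` : sets `P` with `#P ≤ d` admitting a witness in the complex
reflection group `G(m,p,n) = {w ∈ Z_m ≀ S_n : ε_w ≡ 0 (mod p)}`. -/
def APSc (m p n d : ℕ) : Set (Finset (ℕ × ℕ)) :=
  {P | (∃ w, IsGenPerm m n w ∧ p ∣ epsSum n w ∧ pin n w = P) ∧ P.card ≤ d}

theorem Prec.trans {x y z : ℕ × ℕ} (h : Prec x y) (h' : Prec y z) : Prec x z := by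
  unfold Prec at *; omega

theorem Prec.asymm {x y : ℕ × ℕ} (h : Prec x y) : ¬ Prec y x := by
  unfold Prec at *; omega

theorem Prec.irrefl (x : ℕ × ℕ) : ¬ Prec x x := by
  unfold Prec; omega

/-- Every finite set of symbols can be listed increasingly with respect to `Prec`. -/
theorem exists_prec_enumeration (S : Finset (ℕ × ℕ)) :
    ∃ f : ℕ → ℕ × ℕ, (∀ i j, i < j → j < S.card → Prec (f i) (f j)) ∧
      (range S.card).image f = S := by
  induction h : S.card generalizing S with
  | zero => exact ⟨fun _ => (0, 0), by simp, by simpa using (Finset.card_eq_zero.mp h).symm⟩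
  | succ k ih =>
    have hmax : ∃ q ∈ S, ∀ x ∈ S, x ≠ q → Prec x q := by
      have hne : S.Nonempty := Finset.card_pos.mp (by omega)
      obtain ⟨q, hq, hmin⟩ := S.exists_min_image (fun x => toLex x) hne
      refine ⟨q, hq, fun x hx hne => ?_⟩
      have hle := hmin x hx
      rw [Prod.Lex.toLex_le_toLex] at hle
      rcases hle with hlt | ⟨heq, hle⟩
      · exact Or.inl hlt
      · refine Or.inr ⟨heq.symm, lt_of_le_of_ne hle fun h => hne ?_⟩
        exact Prod.ext heq.symm h.symm
    obtain ⟨q, hq, hmax⟩ := hmax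
    obtain ⟨f, hf, himg⟩ := ih (S.erase q) (by rw [card_erase_of_mem hq]; omega)
    refine ⟨Function.update f k q, fun i j hij hj => ?_, ?_⟩
    · rw [Function.update_of_ne (by omega : i ≠ k)]
      by_cases hjk : j = k
      · subst hjk
        rw [Function.update_self]
        have hi : f i ∈ S.erase q := himg ▸ mem_image_of_mem f (mem_range.mpr hij)
        exact hmax _ (mem_of_mem_erase hi) (ne_of_mem_erase hi)
      · rw [Function.update_of_ne hjk]
        exact hf i j hij (by omega)
    · rw [range_add_one, image_insert, Function.update_self,
        image_congr (g := f) (fun i hi => Function.update_of_ne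
          (by have := mem_range.mp (mem_coe.mp hi); omega) _ _), himg, insert_erase hq]

/-- A nonempty finite set of positions has, counting both sides, more neighbours than
elements. -/
theorem card_lt_card_neighbors {J : Finset ℕ} (hJ : J.Nonempty) :
    J.card < (J.image (· + 1) ∪ J.image (· - 1)).card := by
  have hnot : J.min' hJ - 1 ∉ J.image (· + 1) := by
    intro h
    obtain ⟨j, hj, hj'⟩ := mem_image.mp h
    have := J.min'_le j hj
    omega
  calc J.card = (J.image (· + 1)).card := (card_image_of_injective _ (add_left_injective 1)).symm
    _ < (insert (J.min' hJ - 1) (J.image (· + 1))).card := by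
      rw [card_insert_of_notMem hnot]; omega
    _ ≤ _ := card_le_card (insert_subset
      (mem_union_right _ (mem_image_of_mem (· - 1) (J.min'_mem hJ))) subset_union_left)

/-- The symbols of maximal color whose norms do not occur in `P`. -/
def nonPinnacles (m n : ℕ) (P : Finset (ℕ × ℕ)) : Finset (ℕ × ℕ) :=
  (Icc 1 n \ P.image Prod.snd).image fun x => (m - 1, x)

theorem mem_nonPinnacles {m n : ℕ} {P : Finset (ℕ × ℕ)} {y : ℕ × ℕ} :
    y ∈ nonPinnacles m n P ↔ y.1 = m - 1 ∧ y.2 ∈ Icc 1 n ∧ y.2 ∉ P.image Prod.snd := by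
  simp only [nonPinnacles, mem_image (s := _ \ _), mem_sdiff]
  constructor
  · rintro ⟨x, hx, rfl⟩
    exact ⟨rfl, hx⟩
  · rintro ⟨h, hx⟩
    exact ⟨y.2, hx, Prod.ext h.symm rfl⟩

theorem mem_pin {n : ℕ} {w : ℕ → ℕ × ℕ} {q : ℕ × ℕ} :
    q ∈ pin n w ↔ ∃ i, 2 ≤ i ∧ i + 1 ≤ n ∧ Prec (w (i - 1)) (w i) ∧ Prec (w (i + 1)) (w i) ∧
      w i = q := by
  simp only [pin, mem_image, mem_filter, mem_Icc]
  constructor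
  · rintro ⟨i, ⟨⟨h1, h2⟩, h3, h4⟩, h5⟩
    exact ⟨i, h1, by omega, h3, h4, h5⟩
  · rintro ⟨i, h1, h2, h3, h4, h5⟩
    exact ⟨i, ⟨⟨h1, by omega⟩, h3, h4⟩, h5⟩

theorem IsGenPerm.snd_injOn_pin {m n : ℕ} {w : ℕ → ℕ × ℕ} (hw : IsGenPerm m n w) :
    Set.InjOn Prod.snd (pin n w : Set (ℕ × ℕ)) := by
  intro a ha b hb hab
  obtain ⟨i, hi, hi', -, -, rfl⟩ := mem_pin.mp (mem_coe.mp ha)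
  obtain ⟨j, hj, hj', -, -, rfl⟩ := mem_pin.mp (mem_coe.mp hb)
  rw [hw.2 (Set.mem_Icc.mpr ⟨by omega, by omega⟩) (Set.mem_Icc.mpr ⟨by omega, by omega⟩) hab]

/-- If no pinnacle sits at position `j`, then the norm of `w j` is not the norm of a pinnacle. -/
theorem IsGenPerm.snd_notMem_of_notMem_pin {m n : ℕ} {w : ℕ → ℕ × ℕ} (hw : IsGenPerm m n w)
    {j : ℕ} (hj : 1 ≤ j) (hjn : j ≤ n) (h : w j ∉ pin n w) :
    (w j).2 ∉ (pin n w).image Prod.snd := by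
  intro hmem
  obtain ⟨q, hq, hqj⟩ := mem_image.mp hmem
  obtain ⟨i, hi, hi', -, -, rfl⟩ := mem_pin.mp hq
  have := hw.2 (Set.mem_Icc.mpr ⟨by omega, by omega⟩) (Set.mem_Icc.mpr ⟨hj, hjn⟩) hqj
  exact h (this ▸ hq)

theorem IsGenPerm.eq_of_apply_eq {m n : ℕ} {w : ℕ → ℕ × ℕ} (hw : IsGenPerm m n w)
    {i j : ℕ} (hi : 1 ≤ i ∧ i ≤ n) (hj : 1 ≤ j ∧ j ≤ n) (h : w i = w j) : i = j :=
  hw.2 (Set.mem_Icc.mpr hi) (Set.mem_Icc.mpr hj) (congrArg Prod.snd h)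

/-- A set `Q` of pinnacles weakly below `q` is outnumbered by the maximally colored
non-pinnacles below `q`. -/
theorem card_lt_card_nonPinnacles_prec {m n : ℕ} {w : ℕ → ℕ × ℕ} (hw : IsGenPerm m n w)
    {Q : Finset (ℕ × ℕ)} (hQ : Q ⊆ pin n w) (hne : Q.Nonempty) {q : ℕ × ℕ}
    (hle : ∀ x ∈ Q, x = q ∨ Prec x q) :
    Q.card < ((nonPinnacles m n (pin n w)).filter (Prec · q)).card := by
  set J := (Icc 2 (n - 1)).filter
    (fun i => (Prec (w (i - 1)) (w i) ∧ Prec (w (i + 1)) (w i)) ∧ w i ∈ Q) with hJdef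
  have hJ : ∀ j ∈ J, 2 ≤ j ∧ j + 1 ≤ n ∧ Prec (w (j - 1)) (w j) ∧ Prec (w (j + 1)) (w j) ∧
      w j ∈ Q := by
    intro j hj
    simp only [hJdef, mem_filter, mem_Icc] at hj
    exact ⟨hj.1.1, by omega, hj.2.1.1, hj.2.1.2, hj.2.2⟩
  have hQJ : Q ⊆ J.image w := by
    intro x hx
    obtain ⟨i, h1, h2, h3, h4, rfl⟩ := mem_pin.mp (hQ hx)
    refine mem_image_of_mem w ?_
    simp only [hJdef, mem_filter, mem_Icc]
    exact ⟨⟨h1, by omega⟩, ⟨h3, h4⟩, hx⟩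
  have hJne : J.Nonempty := image_nonempty.mp (hne.mono hQJ)
  have hN : ∀ l ∈ J.image (· + 1) ∪ J.image (· - 1),
      1 ≤ l ∧ l ≤ n ∧ w l ∉ pin n w ∧ Prec (w l) q := by
    intro l hl
    simp only [mem_union, mem_image] at hl
    have key : ∀ j ∈ J, (l = j + 1 ∨ l = j - 1) → 1 ≤ l ∧ l ≤ n ∧ w l ∉ pin n w ∧
        Prec (w l) q := by
      intro j hj hlj
      obtain ⟨h1, h2, h3, h4, h5⟩ := hJ j hj
      have hl1 : 1 ≤ l ∧ l ≤ n := by omega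
      have hprec : Prec (w l) (w j) := by rcases hlj with rfl | rfl <;> assumption
      refine ⟨hl1.1, hl1.2, fun hmem => ?_, ?_⟩
      · obtain ⟨i, g1, g2, g3, g4, g5⟩ := mem_pin.mp hmem
        have hil := hw.eq_of_apply_eq ⟨by omega, by omega⟩ hl1 g5
        subst hil
        rcases hlj with rfl | rfl
        · exact hprec.asymm (by simpa using g3)
        · rw [Nat.sub_add_cancel (by omega)] at g4
          exact hprec.asymm g4
      · rcases hle _ h5 with h | h
        · exact h ▸ hprec
        · exact hprec.trans h
    rcases hl with ⟨j, hj, h⟩ | ⟨j, hj, h⟩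
    · exact key j hj (Or.inl h.symm)
    · exact key j hj (Or.inr h.symm)
  calc Q.card ≤ J.card := (card_le_card hQJ).trans card_image_le
    _ < _ := card_lt_card_neighbors hJne
    _ ≤ _ := ?_
  refine card_le_card_of_injOn (fun l => (m - 1, (w l).2)) (fun l hl => ?_) ?_
  · obtain ⟨h1, h2, h3, h4⟩ := hN l hl
    obtain ⟨hc, hnorm⟩ := hw.1 l (mem_Icc.mpr ⟨h1, h2⟩)
    refine mem_coe.mpr (mem_filter.mpr ⟨mem_nonPinnacles.mpr
      ⟨rfl, hnorm, hw.snd_notMem_of_notMem_pin h1 h2 h3⟩, ?_⟩)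
    unfold Prec at *
    simp only
    omega
  · intro a ha b hb hab
    obtain ⟨a1, a2, -, -⟩ := hN a ha
    obtain ⟨b1, b2, -, -⟩ := hN b hb
    exact hw.2 (Set.mem_Icc.mpr ⟨a1, a2⟩) (Set.mem_Icc.mpr ⟨b1, b2⟩) (Prod.mk.inj hab).2

/-- The word `v 0, s 0, v 1, s 1, …, v (k - 1), s (k - 1), v k, v (k + 1), …`,
starting at position `1`. -/
def zigzag (k : ℕ) (s v : ℕ → ℕ × ℕ) (j : ℕ) : ℕ × ℕ :=
  if 2 * k < j then v (j - 1 - k) else if j % 2 = 0 then s (j / 2 - 1) else v (j / 2)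

theorem zigzag_tail {k j : ℕ} (s v : ℕ → ℕ × ℕ) (h : 2 * k < j) :
    zigzag k s v j = v (j - 1 - k) := if_pos h

theorem zigzag_even {k i : ℕ} (s v : ℕ → ℕ × ℕ) (h : i < k) :
    zigzag k s v (2 * i + 2) = s i := by
  rw [zigzag, if_neg (by omega), if_pos (by omega)]
  congr 1; omega

theorem zigzag_odd {k i : ℕ} (s v : ℕ → ℕ × ℕ) (h : i ≤ k) :
    zigzag k s v (2 * i + 1) = v i := by
  rw [zigzag]
  split_ifs with h1 h2
  · congr 1; omega
  · omega
  · congr 1; omega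

theorem position_cases (k j : ℕ) (hj : 1 ≤ j) :
    (∃ i < k, j = 2 * i + 2) ∨ (∃ i < k, j = 2 * i + 1) ∨ 2 * k < j := by
  by_cases h : 2 * k < j
  · exact Or.inr (Or.inr h)
  · rcases Nat.even_or_odd' j with ⟨i, hi | hi⟩
    · exact Or.inl ⟨i - 1, by omega, by omega⟩
    · exact Or.inr (Or.inl ⟨i, by omega, hi⟩)

/-- The zigzag word with its last entry raised still has pinnacle set `{s 0, …, s (k - 1)}`. -/
theorem pin_update_zigzag {k n : ℕ} (hkn : 2 * k + 1 ≤ n) {s v : ℕ → ℕ × ℕ} {z : ℕ × ℕ}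
    (hv : ∀ i j, i < j → j < n - k → Prec (v i) (v j))
    (hsv : ∀ i < k, Prec (v (i + 1)) (s i))
    (hvz : ∀ i, i < n - 1 - k → Prec (v i) z)
    (hzs : ∀ i < k, Prec z (s i) ∨ i + 1 < k) :
    pin n (Function.update (zigzag k s v) n z) = (range k).image s := by
  set u := Function.update (zigzag k s v) n z with hu
  have hlast : u n = z := Function.update_self ..
  have hrest : ∀ j, j ≠ n → u j = zigzag k s v j := fun j hj => Function.update_of_ne hj ..
  have hright : ∀ i < k, Prec (u (2 * i + 3)) (s i) := by
    intro i hi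
    by_cases h : 2 * i + 3 = n
    · rw [h, hlast]
      exact (hzs i hi).resolve_right (by omega)
    · rw [hrest _ h, show 2 * i + 3 = 2 * (i + 1) + 1 by ring, zigzag_odd s v (by omega)]
      exact hsv i hi
  have heven : ∀ i < k, u (2 * i + 2) = s i := fun i hi => by
    rw [hrest _ (by omega), zigzag_even s v hi]
  ext q
  rw [mem_pin, mem_image]
  constructor
  · rintro ⟨j, hj, hjn, hl, hr, rfl⟩
    rcases position_cases k j (by omega) with ⟨i, hi, rfl⟩ | ⟨i, hi, rfl⟩ | h
    · exact ⟨i, mem_range.mpr hi, (heven i hi).symm⟩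
    · obtain ⟨i, rfl⟩ : ∃ i', i = i' + 1 := ⟨i - 1, by omega⟩
      have h1 := hright i (by omega)
      rw [show 2 * (i + 1) + 1 - 1 = 2 * i + 2 by omega, heven i (by omega)] at hl
      exact absurd h1 hl.asymm
    · have h1 : Prec (u j) (u (j + 1)) := by
        rw [hrest j (by omega), zigzag_tail s v h]
        by_cases hjn' : j + 1 = n
        · rw [hjn', hlast]
          exact hvz _ (by omega)
        · rw [hrest _ hjn', zigzag_tail s v (by omega)]
          exact hv _ _ (by omega) (by omega)
      exact absurd hr h1.asymm
  · rintro ⟨i, hi, rfl⟩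
    have hi := mem_range.mp hi
    refine ⟨2 * i + 2, by omega, by omega, ?_, ?_, heven i hi⟩
    · rw [heven i hi, show 2 * i + 2 - 1 = 2 * i + 1 by omega, hrest _ (by omega),
        zigzag_odd s v hi.le]
      exact (hv i (i + 1) (by omega) (by omega)).trans (hsv i hi)
    · rw [heven i hi]
      exact hright i hi

/-- If the norms of `s` and `v` are distinct, the zigzag word has distinct norms. -/
theorem zigzag_snd_injOn {k n : ℕ} (hkn : 2 * k + 1 ≤ n) {s v : ℕ → ℕ × ℕ}
    (hs : ∀ i < k, ∀ j < k, (s i).2 = (s j).2 → i = j)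
    (hv : ∀ i < n - k, ∀ j < n - k, (v i).2 = (v j).2 → i = j)
    (hsv : ∀ i < k, ∀ j < n - k, (s i).2 ≠ (v j).2) :
    Set.InjOn (fun j => (zigzag k s v j).2) (Set.Icc 1 n) := by
  intro a ha b hb hab
  obtain ⟨ha1, ha2⟩ := Set.mem_Icc.mp ha
  obtain ⟨hb1, hb2⟩ := Set.mem_Icc.mp hb
  simp only at hab
  rcases position_cases k a ha1 with ⟨i, hi, rfl⟩ | ⟨i, hi, rfl⟩ | h <;>
  rcases position_cases k b hb1 with ⟨j, hj, rfl⟩ | ⟨j, hj, rfl⟩ | h'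
  · rw [zigzag_even s v hi, zigzag_even s v hj] at hab
    rw [hs i hi j hj hab]
  · rw [zigzag_even s v hi, zigzag_odd s v hj.le] at hab
    exact absurd hab (hsv _ hi _ (by omega))
  · rw [zigzag_even s v hi, zigzag_tail s v h'] at hab
    exact absurd hab (hsv _ hi _ (by omega))
  · rw [zigzag_odd s v hi.le, zigzag_even s v hj] at hab
    exact absurd hab.symm (hsv _ hj _ (by omega))
  · rw [zigzag_odd s v hi.le, zigzag_odd s v hj.le] at hab
    rw [hv i (by omega) j (by omega) hab]
  · rw [zigzag_odd s v hi.le, zigzag_tail s v h'] at hab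
    have := hv _ (by omega) _ (by omega) hab
    omega
  · rw [zigzag_tail s v h, zigzag_even s v hj] at hab
    exact absurd hab.symm (hsv _ hj _ (by omega))
  · rw [zigzag_tail s v h, zigzag_odd s v hj.le] at hab
    have := hv _ (by omega) _ (by omega) hab
    omega
  · rw [zigzag_tail s v h, zigzag_tail s v h'] at hab
    have := hv _ (by omega) _ (by omega) hab
    omega

/-- Any `p` consecutive colors ending at `m - 1` realize every residue modulo `p`. -/
theorem exists_color_dvd_add {m p : ℕ} (hp : 1 ≤ p) (hmp : p ≤ m) (S : ℕ) :
    ∃ c, m - p ≤ c ∧ c < m ∧ p ∣ S + c := by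
  have hlt := Nat.mod_lt (S + m - 1) hp
  refine ⟨m - 1 - (S + m - 1) % p, ?_, by omega, ?_⟩
  · omega
  · have h : S + (m - 1 - (S + m - 1) % p) = (S + m - 1) - (S + m - 1) % p := by omega
    rw [h]
    exact Nat.dvd_sub_mod _

/-- If `m > p` and `P ∈ APS(m, 2r+1)` contains an element of color `< m - p`,
then `P ∈ APS(m, p, 2r+1)`. -/
theorem APSc_mem_of_low_color (m p r : ℕ) (hp : 1 ≤ p) (hr : 1 ≤ r)
    (hpm : p ∣ m) (hmp : p < m)
    (P : Finset (ℕ × ℕ)) (hP : P ∈ APS m (2 * r + 1) r)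
    (hex : ∃ q ∈ P, q.1 < m - p) :
    P ∈ APSc m p (2 * r + 1) r := by
  obtain ⟨⟨w, hw, rfl⟩, hcard⟩ := hP
  obtain ⟨q, hq, hqc⟩ := hex
  refine ⟨?_, hcard⟩
  set n := 2 * r + 1 with hn
  set P := pin n w with hPdef
  set k := P.card with hk
  have hPmem : ∀ x ∈ P, x.1 < m ∧ x.2 ∈ Icc 1 n := by
    intro x hx
    obtain ⟨i, h1, h2, -, -, rfl⟩ := mem_pin.mp hx
    exact hw.1 i (mem_Icc.mpr ⟨by omega, by omega⟩)
  have hVcard : (nonPinnacles m n P).card = n - k := by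
    rw [nonPinnacles, card_image_of_injective _ (fun a b h => congrArg Prod.snd h),
      card_sdiff_of_subset, card_image_of_injOn hw.snd_injOn_pin, Nat.card_Icc, ← hPdef, ← hk]
    · omega
    · intro x hx
      obtain ⟨y, hy, rfl⟩ := mem_image.mp hx
      exact (hPmem y hy).2
  obtain ⟨s, hs, hsP⟩ := exists_prec_enumeration P
  obtain ⟨v, hv, hvV⟩ := exists_prec_enumeration (nonPinnacles m n P)
  rw [hVcard] at hv hvV
  rw [← hk] at hs hsP
  have hsmem : ∀ i < k, s i ∈ P := fun i hi => by
    rw [← hsP]; exact mem_image_of_mem s (mem_range.mpr hi)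
  have hvmem : ∀ i < n - k, (v i).1 = m - 1 ∧ (v i).2 ∈ Icc 1 n ∧
      (v i).2 ∉ P.image Prod.snd := fun i hi => by
    rw [← mem_nonPinnacles, ← hvV]; exact mem_image_of_mem v (mem_range.mpr hi)
  have hsinj : ∀ i < k, ∀ j < k, s i = s j → i = j := by
    intro i hi j hj h
    rcases lt_trichotomy i j with hij | hij | hij
    · exact absurd (h ▸ hs i j hij hj) (Prec.irrefl _)
    · exact hij
    · exact absurd (h ▸ hs j i hij hi) (Prec.irrefl _)
  have hsv : ∀ i < k, Prec (v (i + 1)) (s i) := by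
    intro i hi
    by_contra hcon
    have hsub : (nonPinnacles m n P).filter (Prec · (s i)) ⊆ (range (i + 1)).image v := by
      intro y hy
      obtain ⟨hyV, hyp⟩ := mem_filter.mp hy
      rw [← hvV] at hyV
      obtain ⟨l, hl, rfl⟩ := mem_image.mp hyV
      refine mem_image_of_mem v (mem_range.mpr ?_)
      by_contra hle
      rcases eq_or_lt_of_le (not_lt.mp hle) with rfl | hlt
      · exact hcon hyp
      · exact hcon ((hv _ _ hlt (mem_range.mp hl)).trans hyp)
    have hlt := card_lt_card_nonPinnacles_prec hw (Q := (range (i + 1)).image s) (q := s i)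
      (fun x hx => by
        obtain ⟨l, hl, rfl⟩ := mem_image.mp hx
        exact hsmem l (by have := mem_range.mp hl; omega))
      ⟨s 0, mem_image_of_mem s (by simp)⟩
      (fun x hx => by
        obtain ⟨l, hl, rfl⟩ := mem_image.mp hx
        rcases eq_or_lt_of_le (Nat.lt_succ_iff.mp (mem_range.mp hl)) with rfl | hl
        · exact Or.inl rfl
        · exact Or.inr (hs _ _ hl hi))
    rw [card_image_of_injOn, card_range, ← hPdef] at hlt
    · have := (card_le_card hsub).trans card_image_le
      rw [card_range] at this
      omega
    · intro a ha b hb h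
      have ha := mem_range.mp (mem_coe.mp ha)
      have hb := mem_range.mp (mem_coe.mp hb)
      exact hsinj a (by omega) b (by omega) h
  -- the largest pinnacle has color `< m - p`
  have htop : (s (k - 1)).1 < m - p := by
    rw [← hsP] at hq
    obtain ⟨l, hl, rfl⟩ := mem_image.mp hq
    have hl := mem_range.mp hl
    rcases eq_or_lt_of_le (show l ≤ k - 1 by omega) with rfl | hlt
    · exact hqc
    · have := hs _ _ hlt (by omega)
      unfold Prec at this
      omega
  have hkn : 2 * k + 1 ≤ n := by omega
  obtain ⟨c, hc, hcm, hdvd⟩ := exists_color_dvd_add hp hmp.le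
    (∑ i ∈ Icc 1 (n - 1), (zigzag k s v i).1)
  have hnv : n - 1 - k < n - k := by omega
  have hzn : zigzag k s v n = v (n - 1 - k) := zigzag_tail s v (by omega)
  have hinj := zigzag_snd_injOn hkn
    (fun i hi j hj h => hsinj i hi j hj (hw.snd_injOn_pin (hsmem i hi) (hsmem j hj) h))
    (fun i hi j hj h => by
      have hij : v i = v j := Prod.ext ((hvmem i hi).1.trans (hvmem j hj).1.symm) h
      rcases lt_trichotomy i j with hlt | heq | hlt
      · exact absurd (hij ▸ hv i j hlt hj) (Prec.irrefl _)
      · exact heq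
      · exact absurd (hij ▸ hv j i hlt hi) (Prec.irrefl _))
    (fun i hi j hj h => (hvmem j hj).2.2 (h ▸ mem_image_of_mem Prod.snd (hsmem i hi)))
  have hmem : ∀ j, 1 ≤ j → j ≤ n → (zigzag k s v j).1 < m ∧ (zigzag k s v j).2 ∈ Icc 1 n := by
    intro j hj hjn
    have hv' : ∀ i < n - k, (v i).1 < m ∧ (v i).2 ∈ Icc 1 n := fun i hi =>
      ⟨by have := (hvmem i hi).1; omega, (hvmem i hi).2.1⟩
    rcases position_cases k j hj with ⟨i, hi, rfl⟩ | ⟨i, hi, rfl⟩ | h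
    · rw [zigzag_even s v hi]; exact hPmem _ (hsmem i hi)
    · rw [zigzag_odd s v hi.le]; exact hv' _ (by omega)
    · rw [zigzag_tail s v h]; exact hv' _ (by omega)
  have hsnd : ∀ j, (Function.update (zigzag k s v) n (c, (v (n - 1 - k)).2) j).2 =
      (zigzag k s v j).2 := by
    intro j
    by_cases h : j = n
    · rw [h, Function.update_self, hzn]
    · rw [Function.update_of_ne h]
  refine ⟨Function.update (zigzag k s v) n (c, (v (n - 1 - k)).2), ⟨fun j hj => ?_, ?_⟩, ?_, ?_⟩
  · obtain ⟨hj1, hjn⟩ := mem_Icc.mp hj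
    refine ⟨?_, hsnd j ▸ (hmem j hj1 hjn).2⟩
    by_cases h : j = n
    · rw [h, Function.update_self]; exact hcm
    · rw [Function.update_of_ne h]; exact (hmem j hj1 hjn).1
  · simpa only [hsnd] using hinj
  · have hsum : epsSum n (Function.update (zigzag k s v) n (c, (v (n - 1 - k)).2)) =
        (∑ i ∈ Icc 1 (n - 1), (zigzag k s v i).1) + c := by
      have h1 : n = (n - 1) + 1 := by omega
      rw [epsSum]
      conv_lhs => rw [show Icc 1 n = Icc 1 ((n - 1) + 1) by rw [← h1]]
      rw [sum_Icc_succ_top (by omega), ← h1, Function.update_self]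
      congr 1
      refine sum_congr rfl fun i hi => ?_
      rw [Function.update_of_ne (by have := mem_Icc.mp hi; omega)]
    rw [hsum]; exact hdvd
  · rw [pin_update_zigzag hkn hv hsv, hsP]
    · intro i hi
      have h := hv i (n - 1 - k) hi hnv
      have h1 := (hvmem _ hnv).1
      have h2 := (hvmem i (by omega)).1
      unfold Prec at *
      simp only
      omega
    · intro i hi
      by_cases h : i + 1 < k
      · exact Or.inr h
      · have : i = k - 1 := by omega
        subst this
        exact Or.inl (Or.inl (by simp only; omega))
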